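/- arXiv:2109.06686 — 5 statements merged into one kernel-verified Lean document; each statement's English description precedes it below -/
import Mathlib

section
/- Let d ≥ 1. Let h : ℝ^d × ℝ → ℝ be continuously differentiable with h(y,t) > 0 for all (y,t), let u : ℝ^d → ℝ^d be continuously differentiable, and let φ : ℝ^d × ℝ → ℝ^d be twice continuously differentiable with φ(x,0) = x for all x ∈ ℝ^d and ∂φ/∂t(x,t) = u(φ(x,t)) / h(φ(x,t), t) for all x ∈ ℝ^d and t ∈ [0,1]. Assume the control-increment equation holds: (div u)(y) + (∂h/∂t)(y,t) = 0 for all y ∈ ℝ^d and t ∈ [0,1]. Then for every x ∈ ℝ^d and every t ∈ [0,1], det(D_x φ(x,t)) · h(φ(x,t), t) = h(x, 0); equivalently, det(D_x φ(x,t)) = h(x,0) / h(φ(x,t), t). -/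
open Set

theorem det_diff_aux (d : ℕ) :
    Differentiable ℝ (fun L : EuclideanSpace ℝ (Fin d) →L[ℝ] EuclideanSpace ℝ (Fin d) => L.det) := by
  have : (fun L : EuclideanSpace ℝ (Fin d) →L[ℝ] EuclideanSpace ℝ (Fin d) => L.det)
      = fun L => ∑ σ : Equiv.Perm (Fin d), (((Equiv.Perm.sign σ : ℤ) : ℝ)) *
        ∏ i, (L (EuclideanSpace.basisFun (Fin d) ℝ i)) (σ i) := by
    funext L
    rw [ContinuousLinearMap.det, ← LinearMap.det_toMatrix (EuclideanSpace.basisFun (Fin d) ℝ).toBasis,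
      Matrix.det_apply']
    simp [LinearMap.toMatrix_apply]
  rw [this]
  fun_prop

theorem det_line_aux (d : ℕ) (M : EuclideanSpace ℝ (Fin d) →L[ℝ] EuclideanSpace ℝ (Fin d)) :
    HasDerivAt (fun e : ℝ => (ContinuousLinearMap.id ℝ _ + e • M).det)
      (LinearMap.trace ℝ _ M.toLinearMap) 0 := by
  set b := (EuclideanSpace.basisFun (Fin d) ℝ).toBasis
  set N := LinearMap.toMatrix b b M.toLinearMap with hN
  have h1 := (Matrix.det (1 + (Polynomial.X : Polynomial ℝ) • N.map Polynomial.C)).hasDerivAt 0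
  rw [Matrix.derivative_det_one_add_X_smul, ← LinearMap.trace_eq_matrix_trace] at h1
  convert! h1 using 1
  funext e
  rw [ContinuousLinearMap.det, ← LinearMap.det_toMatrix b, ← Polynomial.coe_evalRingHom,
    RingHom.map_det]
  congr 1
  ext i j
  simp [hN, Matrix.one_apply, LinearMap.toMatrix_apply]
  rw [Finsupp.single_apply, mul_comm]
  by_cases hij : i = j
  · simp [hij]
  · simp [hij, Ne.symm hij]

theorem det_deriv_aux (d : ℕ) (A : ℝ → EuclideanSpace ℝ (Fin d) →L[ℝ] EuclideanSpace ℝ (Fin d))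
    (M : EuclideanSpace ℝ (Fin d) →L[ℝ] EuclideanSpace ℝ (Fin d)) (t : ℝ)
    (hA : HasDerivAt A (M.comp (A t)) t) :
    HasDerivAt (fun s => (A s).det) (LinearMap.trace ℝ _ M.toLinearMap * (A t).det) t := by
  have hD := (det_diff_aux d (A t)).hasFDerivAt
  have h1 := hD.comp_hasDerivAt t hA
  have hl : HasDerivAt (fun e : ℝ => A t + e • M.comp (A t)) (M.comp (A t)) 0 := by
    simpa using ((hasDerivAt_id (0:ℝ)).smul_const (M.comp (A t))).const_add (A t)
  have hD' : HasFDerivAt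
      (fun L : EuclideanSpace ℝ (Fin d) →L[ℝ] EuclideanSpace ℝ (Fin d) => L.det)
      (fderiv ℝ (fun L : EuclideanSpace ℝ (Fin d) →L[ℝ] EuclideanSpace ℝ (Fin d) => L.det) (A t))
      (A t + (0:ℝ) • M.comp (A t)) := by
    have h0 : A t + (0:ℝ) • M.comp (A t) = A t := by
      ext1 v
      simp
    rw [h0]; exact hD
  have h2 := HasFDerivAt.comp_hasDerivAt (0:ℝ) hD' hl
  have h3 := (det_line_aux d M).mul_const (A t).det
  have h4 : ((fun L : EuclideanSpace ℝ (Fin d) →L[ℝ] EuclideanSpace ℝ (Fin d) => L.det) ∘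
      (fun e : ℝ => A t + e • M.comp (A t))) =
      fun e : ℝ => (ContinuousLinearMap.id ℝ _ + e • M).det * (A t).det := by
    funext e
    simp only [Function.comp, ContinuousLinearMap.det]
    rw [← LinearMap.det_comp]
    congr 1
  rw [h4] at h2
  rw [← h2.unique h3]
  exact h1

/-- Construction of the diffeomorphic solution via the control
increment equation: if `∂φ/∂t = u(φ)/h(φ,t)` and `div u + ∂h/∂t = 0`, then
`det(D_x φ(x,t)) · h(φ(x,t),t) = h(x,0)` for all `t ∈ [0,1]`. -/
theorem stmt_0 (d : ℕ) (hd : 1 ≤ d)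
    (h : EuclideanSpace ℝ (Fin d) × ℝ → ℝ)
    (u : EuclideanSpace ℝ (Fin d) → EuclideanSpace ℝ (Fin d))
    (φ : EuclideanSpace ℝ (Fin d) × ℝ → EuclideanSpace ℝ (Fin d))
    (hh : ContDiff ℝ 1 h) (hhpos : ∀ y t, 0 < h (y, t))
    (hu : ContDiff ℝ 1 u) (hφ : ContDiff ℝ 2 φ)
    (hφ0 : ∀ x, φ (x, 0) = x)
    (hφt : ∀ x, ∀ t ∈ Set.Icc (0:ℝ) 1,
      HasDerivAt (fun s => φ (x, s)) ((h (φ (x, t), t))⁻¹ • u (φ (x, t))) t)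
    (hdiv : ∀ y, ∀ t ∈ Set.Icc (0:ℝ) 1,
      LinearMap.trace ℝ (EuclideanSpace ℝ (Fin d)) (fderiv ℝ u y).toLinearMap
        + deriv (fun s => h (y, s)) t = 0) :
    ∀ x, ∀ t ∈ Set.Icc (0:ℝ) 1,
      (fderiv ℝ (fun y => φ (y, t)) x).det * h (φ (x, t), t) = h (x, 0) ∧
      (fderiv ℝ (fun y => φ (y, t)) x).det = h (x, 0) / h (φ (x, t), t) := by
  intro x t ht
  have hφd : Differentiable ℝ φ := hφ.differentiable (by norm_num)
  have hhd : Differentiable ℝ h := hh.differentiable (by norm_num)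
  have hud : Differentiable ℝ u := hu.differentiable (by norm_num)
  have hφ' : Differentiable ℝ (fderiv ℝ φ) :=
    (hφ.fderiv_right (m := 1) (by norm_num)).differentiable (by norm_num)
  have hslice : ∀ y s, HasFDerivAt (fun y => φ (y, s))
      ((fderiv ℝ φ (y, s)).comp (ContinuousLinearMap.inl ℝ _ ℝ)) y := fun y s =>
    (hφd (y, s)).hasFDerivAt.comp y (hasFDerivAt_prodMk_left y s)
  have hft : ∀ y, ∀ s ∈ Icc (0:ℝ) 1, fderiv ℝ φ (y, s) (0, 1)
      = (h (φ (y, s), s))⁻¹ • u (φ (y, s)) := by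
    intro y s hs
    have h1 := (hφd (y, s)).hasFDerivAt.comp_hasDerivAt s
      ((hasDerivAt_const s y).prodMk (hasDerivAt_id s))
    exact h1.unique (hφt y s hs)
  set A : ℝ → EuclideanSpace ℝ (Fin d) →L[ℝ] EuclideanSpace ℝ (Fin d) :=
    fun s => (fderiv ℝ φ (x, s)).comp (ContinuousLinearMap.inl ℝ _ ℝ) with hA
  have key : ∀ s ∈ Icc (0:ℝ) 1,
      HasDerivAt (fun s => (A s).det * h (φ (x, s), s)) 0 s := by
    intro s hs
    set y := φ (x, s) with hy
    -- derivative of h in space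
    set k : EuclideanSpace ℝ (Fin d) →L[ℝ] ℝ :=
      (fderiv ℝ h (y, s)).comp (ContinuousLinearMap.inl ℝ _ ℝ) with hk
    have hk' : HasFDerivAt (fun y => h (y, s)) k y :=
      (hhd (y, s)).hasFDerivAt.comp y (hasFDerivAt_prodMk_left y s)
    have hne : h (y, s) ≠ 0 := (hhpos y s).ne'
    set M : EuclideanSpace ℝ (Fin d) →L[ℝ] EuclideanSpace ℝ (Fin d) :=
      (h (y, s))⁻¹ • fderiv ℝ u y + ((-((h (y, s)) ^ 2)⁻¹) • k).smulRight (u y) with hM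
    have hF : HasFDerivAt (fun z => (h (z, s))⁻¹ • u z) M y := by
      have hi : HasFDerivAt (fun z => (h (z, s))⁻¹) ((-((h (y, s)) ^ 2)⁻¹) • k) y :=
        (hasDerivAt_inv hne).comp_hasFDerivAt y hk'
      exact hi.smul (hud y).hasFDerivAt
    have hAd : HasDerivAt A (M.comp (A s)) s := by
      have h2 := (hφ' (x, s)).hasFDerivAt
      have h3 : HasDerivAt (fun s => fderiv ℝ φ (x, s))
          (fderiv ℝ (fderiv ℝ φ) (x, s) (0, 1)) s :=
        h2.comp_hasDerivAt s ((hasDerivAt_const s x).prodMk (hasDerivAt_id s))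
      have h4 : HasDerivAt A ((fderiv ℝ (fderiv ℝ φ) (x, s) (0, 1)).comp
          (ContinuousLinearMap.inl ℝ _ ℝ)) s := by
        simpa using h3.clm_comp (hasDerivAt_const s (ContinuousLinearMap.inl ℝ _ ℝ))
      convert! h4 using 1
      ext1 v
      have hsym : fderiv ℝ (fderiv ℝ φ) (x, s) (0, 1) (v, 0)
          = fderiv ℝ (fderiv ℝ φ) (x, s) (v, 0) (0, 1) :=
        (hφ.contDiffAt.isSymmSndFDerivAt (by simp)) (0, 1) (v, 0)
      have h5 : HasFDerivAt (fun z => fderiv ℝ φ (z, s))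
          ((fderiv ℝ (fderiv ℝ φ) (x, s)).comp (ContinuousLinearMap.inl ℝ _ ℝ)) x :=
        h2.comp x (hasFDerivAt_prodMk_left x s)
      have h6 := h5.clm_apply (hasFDerivAt_const ((0, 1) : EuclideanSpace ℝ (Fin d) × ℝ) x)
      have h7 : (fun z => fderiv ℝ φ (z, s) (0, 1)) =
          (fun z => (h (z, s))⁻¹ • u z) ∘ (fun z => φ (z, s)) := by
        funext z; exact hft z s hs
      rw [h7] at h6
      have h8 := h6.unique (HasFDerivAt.comp x hF (hslice x s))
      have h9 := congrArg (fun L => L v) h8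
      simp at h9
      simp [hA, hsym, h9]
    have hdet := det_deriv_aux d A M s hAd
    have hhs : HasDerivAt (fun s => h (φ (x, s), s))
        (fderiv ℝ h (y, s) ((h (y, s))⁻¹ • u y, 1)) s :=
      HasFDerivAt.comp_hasDerivAt (f := fun s => (φ (x, s), s)) s (hhd (φ (x, s), s)).hasFDerivAt
        ((hφt x s hs).prodMk (hasDerivAt_id s))
    have hdt : deriv (fun s => h (y, s)) s = fderiv ℝ h (y, s) (0, 1) :=
      ((hhd (y, s)).hasFDerivAt.comp_hasDerivAt s
        ((hasDerivAt_const s y).prodMk (hasDerivAt_id s))).deriv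
    have hsplit : fderiv ℝ h (y, s) ((h (y, s))⁻¹ • u y, 1)
        = (h (y, s))⁻¹ * k (u y) + fderiv ℝ h (y, s) (0, 1) := by
      have : (((h (y, s))⁻¹ • u y, 1) : EuclideanSpace ℝ (Fin d) × ℝ)
          = (h (y, s))⁻¹ • (u y, 0) + (0, 1) := by simp
      rw [this, map_add, map_smul]; simp [hk]
    have htr : LinearMap.trace ℝ _ M.toLinearMap = (h (y, s))⁻¹ *
        LinearMap.trace ℝ _ (fderiv ℝ u y).toLinearMap - ((h (y, s)) ^ 2)⁻¹ * k (u y) := by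
      have : M.toLinearMap = (h (y, s))⁻¹ • (fderiv ℝ u y).toLinearMap +
        ((-((h (y, s)) ^ 2)⁻¹) • k.toLinearMap).smulRight (u y) := rfl
      rw [this, map_add, map_smul, LinearMap.trace_smulRight]
      simp; ring
    have hfin := hdet.mul hhs
    convert! hfin using 1
    have hd0 := hdiv y s hs
    rw [hdt] at hd0
    rw [hsplit, htr, ← hy]
    have : fderiv ℝ h (y, s) (0, 1) =
      - LinearMap.trace ℝ _ (fderiv ℝ u y).toLinearMap := by linarith
    rw [this]
    field_simp
    ring
  have hconst := constant_of_has_deriv_right_zero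
    (fun s hs => (key s hs).continuousAt.continuousWithinAt)
    (fun s hs => (key s (Ico_subset_Icc_self hs)).hasDerivWithinAt) t ht
  have hA0 : A 0 = ContinuousLinearMap.id ℝ _ := by
    have h1 := hslice x 0
    simp only [hφ0] at h1
    exact h1.unique (hasFDerivAt_id x)
  have hfd : fderiv ℝ (fun y => φ (y, t)) x = A t := (hslice x t).fderiv
  have hmain : (A t).det * h (φ (x, t), t) = h (x, 0) := by
    simpa [hA0, hφ0, ContinuousLinearMap.det] using hconst
  rw [hfd]
  exact ⟨hmain, by rw [eq_div_iff (hhpos _ _).ne', hmain]⟩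
end

section
/- Let d ≥ 1, let v : ℝ^d × ℝ → ℝ^d be continuously differentiable, and let φ : ℝ^d × ℝ → ℝ^d be twice continuously differentiable satisfying ∂φ/∂t(x,t) = v(φ(x,t), t) for all x and t. Then for each fixed x ∈ ℝ^d the map t ↦ det(D_x φ(x,t)) is differentiable, and d/dt det(D_x φ(x,t)) = (div_y v)(φ(x,t), t) · det(D_x φ(x,t)), where div_y v(y,t) is the trace of the spatial Jacobian D_y v(y,t). -/
lemma aux_det {n : ℕ} (M : ℝ → Matrix (Fin n) (Fin n) ℝ) (A : Matrix (Fin n) (Fin n) ℝ) (t : ℝ)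
    (h : ∀ i j, HasDerivAt (fun s => M s i j) ((A * M t) i j) t) :
    HasDerivAt (fun s => (M s).det) (A.trace * (M t).det) t := by
  have h1 : HasDerivAt (fun s => (M s).det)
      (∑ σ : Equiv.Perm (Fin n), ((Equiv.Perm.sign σ : ℤ) : ℝ) *
        ∑ i, (∏ j ∈ Finset.univ.erase i, M t j (σ j)) • (A * M t) i (σ i)) t := by
    have : (fun s => (M s).det) = fun s => ∑ σ : Equiv.Perm (Fin n),
        ((Equiv.Perm.sign σ : ℤ) : ℝ) * ∏ i, M s i (σ i) := by
      funext s
      rw [← Matrix.det_transpose, Matrix.det_apply']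
      rfl
    rw [this]
    refine HasDerivAt.fun_sum fun σ _ => HasDerivAt.const_mul _ ?_
    exact HasDerivAt.fun_finsetProd fun i _ => h i (σ i)
  convert h1 using 1
  have h2 : ∀ i, A i i * (M t).det = ((M t).updateRow i ((A * M t) i)).det := by
    intro i
    have : (A * M t) i = ∑ k, A i k • M t k := by
      ext j; simp [Matrix.mul_apply]
    rw [this, Matrix.det_updateRow_sum, smul_eq_mul]
  simp only [Finset.mul_sum]
  rw [Finset.sum_comm, Matrix.trace, Finset.sum_mul]
  refine Finset.sum_congr rfl fun i _ => ?_
  rw [Matrix.diag_apply, h2, ← Matrix.det_transpose, Matrix.det_apply']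
  refine Finset.sum_congr rfl fun σ _ => ?_
  congr 1
  rw [← Finset.prod_erase_mul _ _ (Finset.mem_univ i), smul_eq_mul]
  congr 1
  · refine Finset.prod_congr rfl fun j hj => ?_
    simp [Matrix.updateRow_ne (Finset.ne_of_mem_erase hj)]
  · simp

/-- Liouville's formula for the flow: if `∂φ/∂t(x,t) = v(φ(x,t),t)`,
then `d/dt det(D_x φ(x,t)) = div_y v(φ(x,t),t) · det(D_x φ(x,t))`. -/
theorem stmt_1 (d : ℕ) (hd : 1 ≤ d)
    (v : EuclideanSpace ℝ (Fin d) × ℝ → EuclideanSpace ℝ (Fin d))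
    (φ : EuclideanSpace ℝ (Fin d) × ℝ → EuclideanSpace ℝ (Fin d))
    (hv : ContDiff ℝ 1 v) (hφ : ContDiff ℝ 2 φ)
    (hφt : ∀ x t, HasDerivAt (fun s => φ (x, s)) (v (φ (x, t), t)) t) :
    ∀ x t, HasDerivAt (fun s => (fderiv ℝ (fun y => φ (y, s)) x).det)
      (LinearMap.trace ℝ (EuclideanSpace ℝ (Fin d))
          (fderiv ℝ (fun y => v (y, t)) (φ (x, t))).toLinearMap
        * (fderiv ℝ (fun y => φ (y, t)) x).det) t := by
  intro x t
  have hdφ : Differentiable ℝ φ := hφ.differentiable (by norm_num)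
  have hdv : Differentiable ℝ v := hv.differentiable (by norm_num)
  have hd2 : Differentiable ℝ (fderiv ℝ φ) :=
    (hφ.fderiv_right (m := 1) (by norm_num)).differentiable (by norm_num)
  have hx : ∀ y s, HasFDerivAt (fun y => φ (y, s))
      ((fderiv ℝ φ (y, s)).comp (ContinuousLinearMap.inl ℝ _ ℝ)) y := fun y s =>
    (hdφ (y, s)).hasFDerivAt.comp y (hasFDerivAt_prodMk_left y s)
  have hline : ∀ y s, HasDerivAt (fun s : ℝ => (y, s))
      ((0, 1) : EuclideanSpace ℝ (Fin d) × ℝ) s := fun y s =>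
    (hasDerivAt_const s y).prodMk (hasDerivAt_id s)
  have ht : ∀ y s, fderiv ℝ φ (y, s) (0, 1) = v (φ (y, s), s) := fun y s =>
    ((hdφ (y, s)).hasFDerivAt.comp_hasDerivAt s (hline y s)).unique (hφt y s)
  have hsymm : ∀ h : EuclideanSpace ℝ (Fin d),
      fderiv ℝ (fderiv ℝ φ) (x, t) (0, 1) (h, 0)
        = fderiv ℝ (fun y => v (y, t)) (φ (x, t)) (fderiv ℝ (fun y => φ (y, t)) x h) := by
    intro h
    have hs : IsSymmSndFDerivAt ℝ φ (x, t) :=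
      hφ.contDiffAt.isSymmSndFDerivAt (by simp)
    rw [hs.eq]
    have e1 : HasFDerivAt (fun y => fderiv ℝ φ (y, t) (0, 1))
        (((ContinuousLinearMap.apply ℝ _ ((0, 1) : EuclideanSpace ℝ (Fin d) × ℝ)).comp
          (fderiv ℝ (fderiv ℝ φ) (x, t))).comp (ContinuousLinearMap.inl ℝ _ ℝ)) x := by
      have f1 : HasFDerivAt (fun y => fderiv ℝ φ (y, t))
          ((fderiv ℝ (fderiv ℝ φ) (x, t)).comp (ContinuousLinearMap.inl ℝ _ ℝ)) x :=
        (hd2 (x, t)).hasFDerivAt.comp x (hasFDerivAt_prodMk_left x t)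
      exact (ContinuousLinearMap.apply ℝ (EuclideanSpace ℝ (Fin d))
        ((0, 1) : EuclideanSpace ℝ (Fin d) × ℝ)).hasFDerivAt.comp x f1
    have hv1 : DifferentiableAt ℝ (fun y => v (y, t)) (φ (x, t)) :=
      (hdv.comp (differentiable_id.prodMk (differentiable_const t))).differentiableAt
    have e2 := hv1.hasFDerivAt.comp x (hx x t).differentiableAt.hasFDerivAt
    have e3 : (fun y => fderiv ℝ φ (y, t) (0, 1)) = (fun y => v (y, t)) ∘ (fun y => φ (y, t)) := by
      funext y; exact ht y t
    rw [e3] at e1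
    have := congrArg (fun L => L h) (e1.unique e2)
    simpa using this
  let b := (EuclideanSpace.basisFun (Fin d) ℝ).toBasis
  have key := aux_det
    (fun s => LinearMap.toMatrix b b (fderiv ℝ (fun y => φ (y, s)) x).toLinearMap)
    (LinearMap.toMatrix b b (fderiv ℝ (fun y => v (y, t)) (φ (x, t))).toLinearMap) t ?_
  · simp only [LinearMap.det_toMatrix] at key
    rw [LinearMap.trace_eq_matrix_trace ℝ b]
    exact key
  · intro i j
    rw [← LinearMap.toMatrix_comp]
    simp only [LinearMap.toMatrix_apply]
    have e : HasDerivAt (fun s => fderiv ℝ φ (x, s) (b j, 0))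
        (fderiv ℝ (fderiv ℝ φ) (x, t) (0, 1) (b j, 0)) t :=
      (ContinuousLinearMap.apply ℝ (EuclideanSpace ℝ (Fin d))
        ((b j, 0) : EuclideanSpace ℝ (Fin d) × ℝ)).hasFDerivAt.comp_hasDerivAt t
        ((hd2 (x, t)).hasFDerivAt.comp_hasDerivAt t (hline x t))
    rw [hsymm] at e
    have e' : (fun s => fderiv ℝ φ (x, s) (b j, 0))
        = fun s => fderiv ℝ (fun y => φ (y, s)) x (b j) := by
      funext s; rw [(hx x s).fderiv]; simp
    rw [e'] at e
    have := (EuclideanSpace.proj i : EuclideanSpace ℝ (Fin d) →L[ℝ] ℝ).hasFDerivAt.comp_hasDerivAt t e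
    simpa [b, Function.comp_def] using this
end

section
/- Let d ≥ 1, let h : ℝ^d × ℝ → ℝ be continuously differentiable with h > 0 everywhere, let u : ℝ^d → ℝ^d be continuously differentiable, and let φ : ℝ^d × ℝ → ℝ^d be twice continuously differentiable with ∂φ/∂t(x,t) = u(φ(x,t)) / h(φ(x,t), t). Define H(x,t) = det(D_x φ(x,t)) · h(φ(x,t), t). Then for each fixed x the map t ↦ H(x,t) is differentiable, and d/dt H(x,t) = det(D_x φ(x,t)) · ( (div u)(φ(x,t)) + (∂h/∂t)(φ(x,t), t) ). -/
/-- Derivative of the determinant along a matrix curve with `M' = B M`. -/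
theorem hasDerivAt_matrix_det_aux {n : ℕ} (M : ℝ → Fin n → Fin n → ℝ)
    (B : Matrix (Fin n) (Fin n) ℝ) (t : ℝ)
    (hM : HasDerivAt M (B * (Matrix.of (M t)) : Matrix (Fin n) (Fin n) ℝ) t) :
    HasDerivAt (fun s => (Matrix.of (M s)).det) (B.trace * (Matrix.of (M t)).det) t := by
  let F : (Fin n → Fin n → ℝ) → ℝ := fun N => (Matrix.of N).det
  have hF : Differentiable ℝ F := by
    have : F = fun N => ∑ σ : Equiv.Perm (Fin n),
        ((Equiv.Perm.sign σ : ℤ) : ℝ) * ∏ i, N (σ i) i := by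
      funext N
      simp [F, Matrix.det_apply']
    rw [this]
    fun_prop
  have h1 := (hF (M t)).hasFDerivAt.comp_hasDerivAt t hM
  let X : Fin n → Fin n → ℝ := (B * (Matrix.of (M t)) : Matrix (Fin n) (Fin n) ℝ)
  have hl : HasDerivAt (fun s : ℝ => M t + s • X) X 0 := by
    simpa using ((hasDerivAt_id (0 : ℝ)).smul_const X).const_add (M t)
  have h2 : HasDerivAt (fun s : ℝ => F (M t + s • X)) (fderiv ℝ F (M t) X) 0 := by
    have := (hF (M t + (0 : ℝ) • X)).hasFDerivAt.comp_hasDerivAt 0 hl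
    simpa [Function.comp_def] using this
  have h3 : HasDerivAt (fun s : ℝ => F (M t + s • X)) (B.trace * (Matrix.of (M t)).det) 0 := by
    have e : (fun s : ℝ => F (M t + s • X)) =
        fun s => (1 + s • B).det * (Matrix.of (M t)).det := by
      funext s
      rw [← Matrix.det_mul, add_mul, one_mul, smul_mul_assoc]
      rfl
    rw [e]
    apply HasDerivAt.mul_const
    have e2 : (fun s : ℝ => (1 + s • B).det) = fun s : ℝ =>
        (Matrix.det (1 + (Polynomial.X : Polynomial ℝ) • B.map Polynomial.C)).eval s := by
      funext s
      simp [_root_.eval_det, ← Matrix.smul_eq_mul_diagonal]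
    rw [e2]
    have := (Matrix.det (1 + (Polynomial.X : Polynomial ℝ) • B.map Polynomial.C)).hasDerivAt 0
    rwa [Matrix.derivative_det_one_add_X_smul] at this
  have h4 := h2.unique h3
  have h5 : HasDerivAt (fun s => (Matrix.of (M s)).det) (fderiv ℝ F (M t) X) t := h1
  rwa [h4] at h5

theorem hasDerivAt_clm_det_aux {d : ℕ}
    (A : ℝ → EuclideanSpace ℝ (Fin d) →L[ℝ] EuclideanSpace ℝ (Fin d))
    (B : EuclideanSpace ℝ (Fin d) →L[ℝ] EuclideanSpace ℝ (Fin d)) (t : ℝ)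
    (hA : HasDerivAt A (B ∘L A t) t) :
    HasDerivAt (fun s => (A s).det)
      (LinearMap.trace ℝ _ B.toLinearMap * (A t).det) t := by
  let b := (EuclideanSpace.basisFun (Fin d) ℝ).toBasis
  have hdet : ∀ L : EuclideanSpace ℝ (Fin d) →L[ℝ] EuclideanSpace ℝ (Fin d),
      L.det = (LinearMap.toMatrix b b L.toLinearMap).det := by
    intro L
    rw [LinearMap.det_toMatrix]
  have := hasDerivAt_matrix_det_aux
    (fun s => (LinearMap.toMatrix b b (A s).toLinearMap : Matrix (Fin d) (Fin d) ℝ))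
    (LinearMap.toMatrix b b B.toLinearMap) t ?_
  · rw [LinearMap.trace_eq_matrix_trace ℝ b]
    simp only [hdet]
    exact this
  · have e : (LinearMap.toMatrix b b B.toLinearMap *
      Matrix.of (LinearMap.toMatrix b b (A t).toLinearMap)) =
       LinearMap.toMatrix b b (B ∘L A t).toLinearMap := by
      rw [ContinuousLinearMap.toLinearMap_comp, LinearMap.toMatrix_comp b b b]; rfl
    rw [e]
    refine hasDerivAt_pi.2 fun i => hasDerivAt_pi.2 fun j => ?_
    simp only [LinearMap.toMatrix_apply]
    have h1 := hA.clm_apply (hasDerivAt_const t (b j))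
    have h2 := (EuclideanSpace.proj i : EuclideanSpace ℝ (Fin d) →L[ℝ] ℝ).hasFDerivAt.comp_hasDerivAt t h1
    simpa [b, Function.comp_def] using h2

/-- derivative of `H(x,t) = det(D_x φ(x,t)) · h(φ(x,t),t)` along the
flow `∂φ/∂t = u(φ)/h(φ,t)`:
`d/dt H(x,t) = det(D_x φ(x,t)) · (div u(φ(x,t)) + ∂h/∂t(φ(x,t),t))`. -/
theorem stmt_3 (d : ℕ) (hd : 1 ≤ d)
    (h : EuclideanSpace ℝ (Fin d) × ℝ → ℝ)
    (u : EuclideanSpace ℝ (Fin d) → EuclideanSpace ℝ (Fin d))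
    (φ : EuclideanSpace ℝ (Fin d) × ℝ → EuclideanSpace ℝ (Fin d))
    (hh : ContDiff ℝ 1 h) (hhpos : ∀ y t, 0 < h (y, t))
    (hu : ContDiff ℝ 1 u) (hφ : ContDiff ℝ 2 φ)
    (hφt : ∀ x t, HasDerivAt (fun s => φ (x, s))
      ((h (φ (x, t), t))⁻¹ • u (φ (x, t))) t)
    (H : EuclideanSpace ℝ (Fin d) → ℝ → ℝ)
    (hH : ∀ x t, H x t = (fderiv ℝ (fun y => φ (y, t)) x).det * h (φ (x, t), t)) :
    ∀ x t, HasDerivAt (fun s => H x s)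
      ((fderiv ℝ (fun y => φ (y, t)) x).det *
        (LinearMap.trace ℝ (EuclideanSpace ℝ (Fin d))
            (fderiv ℝ u (φ (x, t))).toLinearMap
          + deriv (fun s => h (φ (x, t), s)) t)) t := by
  intro x t
  have hφd : Differentiable ℝ φ := hφ.differentiable (by norm_num)
  have hhd : Differentiable ℝ h := hh.differentiable (by norm_num)
  have hud : Differentiable ℝ u := hu.differentiable (by norm_num)
  have hφ' : Differentiable ℝ (fderiv ℝ φ) :=
    (hφ.fderiv_right (m := 1) (by norm_num)).differentiable (by norm_num)
  let E := EuclideanSpace ℝ (Fin d)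
  -- partial derivatives of φ
  have hx : ∀ y s, HasFDerivAt (fun y => φ (y, s))
      ((fderiv ℝ φ (y, s)) ∘L (ContinuousLinearMap.inl ℝ E ℝ)) y := fun y s =>
    (hφd (y, s)).hasFDerivAt.comp y (hasFDerivAt_prodMk_left y s)
  have ht : ∀ y s, fderiv ℝ φ (y, s) (0, 1) = (h (φ (y, s), s))⁻¹ • u (φ (y, s)) := by
    intro y s
    have h1 : HasDerivAt (fun r : ℝ => (y, r)) ((0 : E), (1 : ℝ)) s :=
      (hasDerivAt_const s y).prodMk (hasDerivAt_id s)
    exact ((hφd (y, s)).hasFDerivAt.comp_hasDerivAt s h1).unique (hφt y s)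
  -- the velocity field at time t
  let p := φ (x, t)
  let Hx : E →L[ℝ] ℝ := (fderiv ℝ h (p, t)) ∘L (ContinuousLinearMap.inl ℝ E ℝ)
  have hHx : HasFDerivAt (fun y => h (y, t)) Hx p :=
    (hhd (p, t)).hasFDerivAt.comp p (hasFDerivAt_prodMk_left p t)
  have hne : h (p, t) ≠ 0 := (hhpos p t).ne'
  have hinv : HasFDerivAt (fun y => (h (y, t))⁻¹) (-((h (p, t)) ^ 2)⁻¹ • Hx) p :=
    (hasDerivAt_inv hne).comp_hasFDerivAt p hHx
  let B : E →L[ℝ] E := (h (p, t))⁻¹ • fderiv ℝ u p +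
    (-((h (p, t)) ^ 2)⁻¹ • Hx).smulRight (u p)
  have hB : HasFDerivAt (fun y => (h (y, t))⁻¹ • u y) B p :=
    hinv.smul (hud p).hasFDerivAt
  have htr : LinearMap.trace ℝ E B.toLinearMap =
      (h (p, t))⁻¹ * LinearMap.trace ℝ E (fderiv ℝ u p).toLinearMap
        - ((h (p, t)) ^ 2)⁻¹ * Hx (u p) := by
    have e : B.toLinearMap = (h (p, t))⁻¹ • (fderiv ℝ u p).toLinearMap +
      (-((h (p, t)) ^ 2)⁻¹ • Hx).toLinearMap.smulRight (u p) := rfl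
    rw [e, map_add, map_smul, LinearMap.trace_smulRight]
    simp
    ring
  -- derivative of the Jacobian
  have hA : HasDerivAt (fun s => fderiv ℝ (fun y => φ (y, s)) x)
      (B ∘L fderiv ℝ (fun y => φ (y, t)) x) t := by
    have e : (fun s => fderiv ℝ (fun y => φ (y, s)) x) =
        fun s => (fderiv ℝ φ (x, s)) ∘L (ContinuousLinearMap.inl ℝ E ℝ) := by
      funext s; exact (hx x s).fderiv
    rw [e]
    have h1 : HasDerivAt (fun r : ℝ => (x, r)) ((0 : E), (1 : ℝ)) t :=
      (hasDerivAt_const t x).prodMk (hasDerivAt_id t)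
    have h2 := (hφ' (x, t)).hasFDerivAt.comp_hasDerivAt t h1
    have h3 := h2.clm_comp (hasDerivAt_const t (ContinuousLinearMap.inl ℝ E ℝ))
    convert! h3 using 1
    ext1 v
    have hsym : IsSymmSndFDerivAt ℝ φ (x, t) :=
      hφ.contDiffAt.isSymmSndFDerivAt (by simp)
    have h4 : HasFDerivAt (fun y => fderiv ℝ φ (y, t) (0, 1))
        (((fderiv ℝ (fderiv ℝ φ) (x, t)) ∘L (ContinuousLinearMap.inl ℝ E ℝ)).flip (0, 1)) x := by
      have h0 : HasFDerivAt (fun y => fderiv ℝ φ (y, t))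
          ((fderiv ℝ (fderiv ℝ φ) (x, t)) ∘L (ContinuousLinearMap.inl ℝ E ℝ)) x :=
        (hφ' (x, t)).hasFDerivAt.comp x (hasFDerivAt_prodMk_left x t)
      have := h0.clm_apply
        (hasFDerivAt_const ((0 : E), (1 : ℝ)) x)
      simpa using this
    have h5 : HasFDerivAt (fun y => fderiv ℝ φ (y, t) (0, 1))
        (B ∘L fderiv ℝ (fun y => φ (y, t)) x) x := by
      simp only [ht]
      have := hB.comp x (hx x t).differentiableAt.hasFDerivAt
      exact this
    rw [h5.unique h4]
    simpa using! hsym (v, 0) (0, 1)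
  have hdet := hasDerivAt_clm_det_aux _ B t hA
  -- derivative of h along the flow
  have hht : HasDerivAt (fun s => h (p, s)) (fderiv ℝ h (p, t) (0, 1)) t :=
    (hhd (p, t)).hasFDerivAt.comp_hasDerivAt t
      ((hasDerivAt_const t p).prodMk (hasDerivAt_id t))
  have hhφ : HasDerivAt (fun s => h (φ (x, s), s))
      ((h (p, t))⁻¹ * Hx (u p) + fderiv ℝ h (p, t) (0, 1)) t := by
    have h0 : HasDerivAt (fun s => (φ (x, s), s)) ((h (p, t))⁻¹ • u p, (1 : ℝ)) t :=
      (hφt x t).prodMk (hasDerivAt_id t)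
    have h1 := HasFDerivAt.comp_hasDerivAt (f := fun s => (φ (x, s), s)) t
      (hhd (p, t)).hasFDerivAt h0
    convert! h1 using 1
    have e : ((h (p, t))⁻¹ • u p, (1 : ℝ)) = (h (p, t))⁻¹ • (u p, (0 : ℝ)) + ((0 : E), (1 : ℝ)) := by
      simp
    change _ = fderiv ℝ h (p, t) ((h (p, t))⁻¹ • u p, (1 : ℝ))
    rw [e, map_add, map_smul]
    rfl
  have hfin := hdet.mul hhφ
  have e : (fun s => H x s) =
      fun s => (fderiv ℝ (fun y => φ (y, s)) x).det * h (φ (x, s), s) := by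
    funext s; exact hH x s
  rw [e, hht.deriv]
  convert! hfin using 1
  rw [htr]
  change _ * (LinearMap.trace ℝ E (fderiv ℝ u p).toLinearMap + _) = _ * h (p, t) + _
  field_simp
  ring
end

section
/- Let Ω ⊆ ℝ^d be measurable with finite Lebesgue measure μ(Ω) < ∞, let M₀ > 0, let T : ℝ^d → ℝ be differentiable with |T(y)| ≤ M₀ and ‖∇T(y)‖ ≤ M₀ for all y ∈ ℝ^d, and let R : Ω → ℝ be measurable with |R(x)| ≤ M₀ for all x ∈ Ω. For measurable u : Ω → ℝ^d define the SSD functional W(u) = (1/2)∫_Ω (T(x + u(x)) − R(x))² dx. Then W(u) is finite for every measurable u, and there exist constants c₁, c₂ ≥ 0 (one may take c₁ = 2M₀²·(μ(Ω))^{1/2} and c₂ = 0) such that for all measurable u, v : Ω → ℝ^d with finite L² norm, |W(u) − W(v)| ≤ c₁‖u − v‖_{L²(Ω)} + c₂‖u − v‖²_{L²(Ω)}. -/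
open MeasureTheory

/-- the SSD functional `W(u) = (1/2)∫_Ω (T(x+u(x)) − R(x))² dx`
is finite for every measurable displacement, and is Lipschitz-type continuous
with respect to the `L²(Ω)` norm of the displacement difference. -/
theorem stmt_5 (d : ℕ) (hd : 1 ≤ d)
    (Ω : Set (EuclideanSpace ℝ (Fin d))) (hΩmeas : MeasurableSet Ω)
    (hΩfin : volume Ω < ⊤) (M₀ : ℝ) (hM₀ : 0 < M₀)
    (T : EuclideanSpace ℝ (Fin d) → ℝ) (hT : Differentiable ℝ T)
    (hTbd : ∀ y, |T y| ≤ M₀) (hTgrad : ∀ y, ‖fderiv ℝ T y‖ ≤ M₀)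
    (R : EuclideanSpace ℝ (Fin d) → ℝ) (hRmeas : Measurable R)
    (hRbd : ∀ x ∈ Ω, |R x| ≤ M₀)
    (W : (EuclideanSpace ℝ (Fin d) → EuclideanSpace ℝ (Fin d)) → ℝ)
    (hW : ∀ u, W u = (1 / 2) * ∫ x in Ω, (T (x + u x) - R x) ^ 2) :
    (∀ u : EuclideanSpace ℝ (Fin d) → EuclideanSpace ℝ (Fin d), Measurable u →
      IntegrableOn (fun x => (T (x + u x) - R x) ^ 2) Ω volume) ∧
    (∃ c₁ c₂ : ℝ, 0 ≤ c₁ ∧ 0 ≤ c₂ ∧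
      c₁ = 2 * M₀ ^ 2 * Real.sqrt ((volume Ω).toReal) ∧ c₂ = 0 ∧
      ∀ u v : EuclideanSpace ℝ (Fin d) → EuclideanSpace ℝ (Fin d),
        Measurable u → Measurable v →
        IntegrableOn (fun x => ‖u x‖ ^ 2) Ω volume →
        IntegrableOn (fun x => ‖v x‖ ^ 2) Ω volume →
        |W u - W v| ≤
          c₁ * Real.sqrt (∫ x in Ω, ‖u x - v x‖ ^ 2) +
          c₂ * Real.sqrt (∫ x in Ω, ‖u x - v x‖ ^ 2) ^ 2) := by
  have hTlip : ∀ y z, |T y - T z| ≤ M₀ * ‖y - z‖ := by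
    intro y z
    have := Convex.norm_image_sub_le_of_norm_fderiv_le (𝕜 := ℝ) (f := T) (s := Set.univ)
      (fun x _ => hT x) (fun x _ => hTgrad x) convex_univ (Set.mem_univ z) (Set.mem_univ y)
    simpa [Real.norm_eq_abs] using this
  have hfin : IsFiniteMeasure (volume.restrict Ω) := ⟨by simpa using hΩfin⟩
  have hint : ∀ u : EuclideanSpace ℝ (Fin d) → EuclideanSpace ℝ (Fin d), Measurable u →
      IntegrableOn (fun x => (T (x + u x) - R x) ^ 2) Ω volume := by
    intro u hu
    have hm : Measurable (fun x => (T (x + u x) - R x) ^ 2) :=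
      ((hT.continuous.measurable.comp (measurable_id.add hu)).sub hRmeas).pow_const 2
    refine Integrable.of_bound hm.aestronglyMeasurable ((2 * M₀) ^ 2) ?_
    filter_upwards [ae_restrict_mem hΩmeas] with x hx
    rw [Real.norm_eq_abs, abs_of_nonneg (sq_nonneg _)]
    have h1 := abs_le.1 (hTbd (x + u x))
    have h2 := abs_le.1 (hRbd x hx)
    exact sq_le_sq' (by linarith) (by linarith)
  refine ⟨hint, _, _, by positivity, le_refl 0, rfl, rfl, ?_⟩
  intro u v hu hv hu2 hv2
  have hmu : MemLp u 2 (volume.restrict Ω) :=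
    (memLp_two_iff_integrable_sq_norm hu.aestronglyMeasurable).2 hu2
  have hmv : MemLp v 2 (volume.restrict Ω) :=
    (memLp_two_iff_integrable_sq_norm hv.aestronglyMeasurable).2 hv2
  have hmd : MemLp (fun x => ‖u x - v x‖) 2 (volume.restrict Ω) := (hmu.sub hmv).norm
  have hg : Integrable (fun x => ‖u x - v x‖) (volume.restrict Ω) :=
    hmd.integrable (by norm_num)
  have hCS : ∫ x in Ω, ‖u x - v x‖ ≤
      Real.sqrt ((volume Ω).toReal) * Real.sqrt (∫ x in Ω, ‖u x - v x‖ ^ 2) := by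
    have h := integral_mul_le_Lp_mul_Lq_of_nonneg (μ := volume.restrict Ω)
      (f := fun _ => (1 : ℝ)) (g := fun x => ‖u x - v x‖) Real.HolderConjugate.two_two
      (Filter.Eventually.of_forall fun _ => zero_le_one)
      (Filter.Eventually.of_forall fun _ => norm_nonneg _)
      (memLp_const _) (by simpa using hmd)
    simpa [Real.sqrt_eq_rpow, Measure.real] using h
  have hmain : |∫ x in Ω, ((T (x + u x) - R x) ^ 2 - (T (x + v x) - R x) ^ 2)| ≤
      ∫ x in Ω, 4 * M₀ ^ 2 * ‖u x - v x‖ := by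
    rw [← Real.norm_eq_abs]
    refine norm_integral_le_of_norm_le (hg.const_mul _) ?_
    filter_upwards [ae_restrict_mem hΩmeas] with x hx
    have h1 := abs_le.1 (hTbd (x + u x))
    have h2 := abs_le.1 (hRbd x hx)
    have h3 := abs_le.1 (hTbd (x + v x))
    have h4 := hTlip (x + u x) (x + v x)
    rw [add_sub_add_left_eq_sub] at h4
    have h5 : |T (x + u x) + T (x + v x) - 2 * R x| ≤ 4 * M₀ :=
      abs_le.2 ⟨by linarith, by linarith⟩
    rw [Real.norm_eq_abs]
    calc _ = |T (x + u x) - T (x + v x)| * |T (x + u x) + T (x + v x) - 2 * R x| := by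
          rw [← abs_mul]; congr 1; ring
      _ ≤ (M₀ * ‖u x - v x‖) * (4 * M₀) := by gcongr
      _ = _ := by ring
  rw [integral_sub (hint u hu) (hint v hv), integral_const_mul] at hmain
  rw [hW, hW, ← mul_sub, abs_mul, abs_of_pos (by norm_num : (0 : ℝ) < 1 / 2)]
  have h6 := mul_le_mul_of_nonneg_left hCS (by positivity : 0 ≤ 2 * M₀ ^ 2)
  linarith
end

section
/- Let H₁ and H₂ be real Hilbert spaces, E : H₁ → ℝ, A : H₁ → H₂ a continuous linear map, b ∈ H₂, and β, γ > 0. Let u*, uⁱ, u^{i+1} ∈ H₁ and λ*, λⁱ, λ^{i+1} ∈ H₂ satisfy: (saddle-point inequalities) E(u^{i+1}) − E(u*) − ⟨λ*, A(u^{i+1} − u*)⟩ ≥ 0 and ⟨λ^{i+1} − λ*, Au* + b⟩ ≥ 0; and (iterate variational inequalities) E(u*) − E(u^{i+1}) + (1/γ)⟨u* − u^{i+1}, u^{i+1} − uⁱ⟩ − ⟨λ^{i+1}, A(u* − u^{i+1})⟩ ≥ 0 and ⟨λ* − λ^{i+1}, (Au^{i+1} + b) + (1/β)(λ^{i+1}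 − λⁱ)⟩ ≥ 0. Then the Fejér-type inequality holds: (β/γ)‖u^{i+1} − u*‖² + ‖λ^{i+1} − λ*‖² + (β/γ)‖u^{i+1} − uⁱ‖² + ‖λ^{i+1} − λⁱ‖² ≤ (β/γ)‖uⁱ − u*‖² + ‖λⁱ − λ*‖². -/
open scoped RealInnerProductSpace

/-- Fejér-type inequality for the ALMM iterates: from the
saddle-point inequalities and the iterate variational inequalities one gets
`(β/γ)‖u^{i+1}−u*‖² + ‖λ^{i+1}−λ*‖² + (β/γ)‖u^{i+1}−uⁱ‖² + ‖λ^{i+1}−λⁱ‖²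
  ≤ (β/γ)‖uⁱ−u*‖² + ‖λⁱ−λ*‖²`. -/
theorem stmt_9 (H₁ H₂ : Type*)
    [NormedAddCommGroup H₁] [InnerProductSpace ℝ H₁] [CompleteSpace H₁]
    [NormedAddCommGroup H₂] [InnerProductSpace ℝ H₂] [CompleteSpace H₂]
    (E : H₁ → ℝ) (A : H₁ →L[ℝ] H₂) (b : H₂) (β γ : ℝ) (hβ : 0 < β) (hγ : 0 < γ)
    (ustar ui ui1 : H₁) (lamstar lami lami1 : H₂)
    (hsaddle1 : 0 ≤ E ui1 - E ustar - ⟪lamstar, A (ui1 - ustar)⟫)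
    (hsaddle2 : 0 ≤ ⟪lami1 - lamstar, A ustar + b⟫)
    (hiter1 : 0 ≤ E ustar - E ui1 + (1 / γ) * ⟪ustar - ui1, ui1 - ui⟫
        - ⟪lami1, A (ustar - ui1)⟫)
    (hiter2 : 0 ≤ ⟪lamstar - lami1, (A ui1 + b) + (1 / β) • (lami1 - lami)⟫) :
    (β / γ) * ‖ui1 - ustar‖ ^ 2 + ‖lami1 - lamstar‖ ^ 2
      + (β / γ) * ‖ui1 - ui‖ ^ 2 + ‖lami1 - lami‖ ^ 2
    ≤ (β / γ) * ‖ui - ustar‖ ^ 2 + ‖lami - lamstar‖ ^ 2 := by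
  have key : ∀ {H : Type _} [NormedAddCommGroup H] [InnerProductSpace ℝ H] (s x y : H),
      ‖x - s‖ ^ 2 = ‖y - s‖ ^ 2 + ‖y - x‖ ^ 2 + 2 * ⟪s - y, y - x⟫ := by
    intro H _ _ s x y
    have h : x - s = -((s - y) + (y - x)) := by abel
    rw [h, norm_neg, norm_add_sq_real, norm_sub_rev s y]
    ring
  have key₂ : ‖lami - lamstar‖ ^ 2 = ‖lami1 - lamstar‖ ^ 2 + ‖lami1 - lami‖ ^ 2
      + 2 * ⟪lamstar - lami1, lami1 - lami⟫ := by
    have h : lami - lamstar = -((lamstar - lami1) + (lami1 - lami)) := by abel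
    rw [h, norm_neg, norm_add_sq_real, norm_sub_rev lamstar lami1]
    ring
  rw [key ustar ui ui1, key₂]
  rw [inner_add_right, real_inner_smul_right] at hiter2
  generalize ⟪lamstar - lami1, lami1 - lami⟫ = Q at *
  generalize ⟪ustar - ui1, ui1 - ui⟫ = P at *
  simp only [map_sub, inner_sub_left, inner_sub_right, inner_add_right] at hsaddle1 hsaddle2 hiter1 hiter2
  have h : 0 ≤ (1 / γ) * P + (1 / β) * Q := by linarith
  have h2 : 0 ≤ β * ((1 / γ) * P + (1 / β) * Q) := mul_nonneg hβ.le h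
  have h3 : β * ((1 / γ) * P + (1 / β) * Q) = (β / γ) * P + Q := by
    field_simp
  rw [h3] at h2
  linarith
end
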